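/- arXiv:2402.17055 — 2 statements merged into one kernel-verified Lean document; each statement's English description precedes it below -/
import Mathlib

section
/- Let s = (1 2 3 4 5)(6 7 8 9 10) and t = (1 6)(2 4)(7 11)(8 12)(9 13)(10 14) be permutations of {1,...,14}. Then s·t has order 12 and ⟨s,t⟩ = A₁₄. -/
open Equiv

open scoped Pointwise in
/-- A permutation group is primitive if it contains a cycle fixing exactly one point `a` and an
element moving `a`. -/
theorem isPreprimitive_of_isCycle_of_support_eq_compl {α : Type*} [Fintype α] [DecidableEq α]
    {G : Subgroup (Perm α)} {a : α} {g h : Perm α} (hg : g ∈ G) (hcycle : g.IsCycle)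
    (hsupp : g.support = {a}ᶜ) (hh : h ∈ G) (ha : h a ≠ a) :
    MulAction.IsPreprimitive G α := by
  have hmove : ∀ x, g x ≠ x ↔ x ≠ a := fun x => by
    rw [← Perm.mem_support, hsupp, Finset.mem_compl, Finset.mem_singleton]
  have hfix : g a = a := by simpa using (hmove a).not
  have : MulAction.IsPretransitive G α := by
    refine MulAction.isPretransitive_iff_base a |>.mpr fun x => ?_
    by_cases hx : x = a
    · exact ⟨1, by simp [hx]⟩
    · obtain ⟨n, hn⟩ := hcycle.exists_pow_eq ((hmove _).2 ha) ((hmove x).2 hx)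
      exact ⟨⟨g ^ n * h, G.mul_mem (G.pow_mem hg n) hh⟩, hn⟩
  refine MulAction.IsPreprimitive.of_isTrivialBlock_base a fun {B} haB hB => ?_
  by_cases hb : ∃ b ∈ B, b ≠ a
  · obtain ⟨b, hbB, hba⟩ := hb
    refine Or.inr (Set.eq_univ_of_forall fun x => ?_)
    by_cases hx : x = a
    · exact hx ▸ haB
    · obtain ⟨n, hn⟩ := hcycle.exists_pow_eq ((hmove b).2 hba) ((hmove x).2 hx)
      have hBn : (⟨g ^ n, G.pow_mem hg n⟩ : G) • B = B :=
        hB.smul_eq_of_mem haB (by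
          change (g ^ n) a ∈ B
          rwa [Perm.pow_apply_eq_self_of_apply_eq_self hfix n])
      rw [← hBn, ← hn]
      exact Set.smul_mem_smul_set hbB
  · push Not at hb
    exact Or.inl fun x hx y hy => (hb x hx).trans (hb y hy).symm

theorem stmt5 :
    let s : Equiv.Perm (Fin 14) := c[1,2,3,4,5] * c[6,7,8,9,10]
    let t : Equiv.Perm (Fin 14) := c[1,6] * c[2,4] * c[7,11] * c[8,12] * c[9,13] * c[10,14]
    orderOf (s * t) = 12 ∧ Subgroup.closure {s, t} = alternatingGroup (Fin 14) := by
  intro s t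
  have hs : s ∈ Subgroup.closure {s, t} := Subgroup.subset_closure (by simp)
  have ht : t ∈ Subgroup.closure {s, t} := Subgroup.subset_closure (by simp)
  have hst := mul_mem hs ht
  constructor
  · refine orderOf_eq_of_pow_and_pow_div_prime (by norm_num) (by decide +kernel) fun p hp hd => ?_
    have : p = 2 ∨ p = 3 := by
      have h12 : p ∈ Nat.primeFactors 12 := Nat.mem_primeFactors.2 ⟨hp, hd, by norm_num⟩
      have hpf : Nat.primeFactors 12 = {2, 3} := by decide +kernel
      simpa [hpf] using h12
    rcases this with rfl | rfl <;> decide +kernel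
  · apply le_antisymm
    · rw [Subgroup.closure_le]
      rintro x (rfl | rfl)
      · exact Perm.mem_alternatingGroup.2 (by decide +kernel)
      · exact Perm.mem_alternatingGroup.2 (by decide +kernel)
    · refine Perm.alternatingGroup_le_of_isPreprimitive_of_isThreeCycle_mem
        (isPreprimitive_of_isCycle_of_support_eq_compl (a := 4) (g := s ^ 2 * t) (h := t)
          (mul_mem (pow_mem hs 2) ht) ?_ (by decide +kernel) ht (by decide +kernel))
        (g := (s * t * (s * t) * (s ^ 3 * t)) ^ 14) ?_
        (pow_mem (mul_mem (mul_mem hst hst) (mul_mem (pow_mem hs 3) ht)) 14)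
      · have : s ^ 2 * t = c[0, 7, 11, 9, 13, 6, 3, 5, 2, 1, 8, 12, 10] := by decide +kernel
        rw [this]
        exact List.isCycle_formPerm (by decide) (by decide)
      · exact card_support_eq_three_iff.1 (by decide +kernel)
end

section
/- Let s = (1 2 3 4 5 6 7 8 9)(10 11 12)(13 17 18)(14 19 20)(15 21 22) and t = (1 10)(2 12)(3 13)(4 14)(5 15)(6 16) be permutations of {1,...,22}. Then s·t has order 20 and ⟨s,t⟩ = A₂₂. -/
open Equiv

open MulAction in
/-- An action is primitive if some `w` fixes `a`, its powers move `b` to every point other than `a`,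
and some `h` moves `b` to `a`. -/
theorem isPreprimitive_of_zpow_smul_eq {G α : Type*} [Group G] [MulAction G α] {a b : α} {w h : G}
    (hw : w • a = a) (hh : h • b = a) (hwb : ∀ x, x ≠ a → ∃ i : ℤ, w ^ i • b = x) :
    IsPreprimitive G α := by
  have hbase (x : α) : ∃ g : G, g • b = x := by
    by_cases hx : x = a
    · exact ⟨h, hx ▸ hh⟩
    · obtain ⟨i, hi⟩ := hwb x hx
      exact ⟨w ^ i, hi⟩
  have hwa (i : ℤ) : w ^ i • a = a := (stabilizer G a).zpow_mem (x := w) hw i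
  have key {x y : α} (hxy : x ≠ y) : ∃ g : G, g • a = x ∧ g • b = y := by
    obtain ⟨k, rfl⟩ := hbase x
    have hya : (k * h⁻¹)⁻¹ • y ≠ a := by
      intro he
      apply hxy
      rw [inv_smul_eq_iff] at he
      rw [he, mul_smul, inv_smul_eq_iff.mpr hh.symm]
    obtain ⟨i, hi⟩ := hwb _ hya
    refine ⟨k * h⁻¹ * w ^ i, ?_, ?_⟩
    · rw [mul_smul, hwa, mul_smul, inv_smul_eq_iff.mpr hh.symm]
    · rw [mul_smul, hi, smul_inv_smul]
  refine isPreprimitive_of_is_two_pretransitive (is_two_pretransitive_iff.mpr ?_)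
  intro x y z u hxy hzu
  obtain ⟨g, rfl, rfl⟩ := key hxy
  obtain ⟨k, rfl, rfl⟩ := key hzu
  exact ⟨k * g⁻¹, by simp [mul_smul], by simp [mul_smul]⟩

theorem stmt15 :
    let s : Equiv.Perm (Fin 22) := c[1,2,3,4,5,6,7,8,9] * c[10,11,12] * c[13,17,18] * c[14,19,20] * c[15,21,22]
    let t : Equiv.Perm (Fin 22) := c[1,10] * c[2,12] * c[3,13] * c[4,14] * c[5,15] * c[6,16]
    orderOf (s * t) = 20 ∧ Subgroup.closure {s, t} = alternatingGroup (Fin 22) := by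
  intro s t
  have hs : s ∈ Subgroup.closure {s, t} := Subgroup.subset_closure (by simp)
  have ht : t ∈ Subgroup.closure {s, t} := Subgroup.subset_closure (by simp)
  constructor
  · have h20 : (s * t) ^ 20 = 1 := by decide +kernel
    have h10 : (s * t) ^ 10 ≠ 1 := by decide +kernel
    have h4 : (s * t) ^ 4 ≠ 1 := by decide +kernel
    refine orderOf_eq_of_pow_and_pow_div_prime (by norm_num) h20 fun p hp hdvd => ?_
    have hmem : p ∈ Nat.primeFactors 20 := Nat.mem_primeFactors.mpr ⟨hp, hdvd, by norm_num⟩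
    rw [show Nat.primeFactors 20 = {2, 5} by decide +kernel] at hmem
    simp only [Finset.mem_insert, Finset.mem_singleton] at hmem
    rcases hmem with rfl | rfl
    · exact h10
    · exact h4
  · apply le_antisymm
    · rw [Subgroup.closure_le]
      rintro x (rfl | rfl)
      · show Perm.sign s = 1
        decide +kernel
      · show Perm.sign t = 1
        decide +kernel
    · have hw : s * t * s ^ 2 * t * s ^ 2 * t ∈ Subgroup.closure {s, t} := by
        exact mul_mem (mul_mem (mul_mem (mul_mem (mul_mem hs ht) (pow_mem hs 2)) ht) (pow_mem hs 2)) ht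
      have hc : (s ^ 4 * t * s ^ 5 * t) ^ 2 ∈ Subgroup.closure {s, t} := by
        exact pow_mem (mul_mem (mul_mem (mul_mem (pow_mem hs 4) ht) (pow_mem hs 5)) ht) 2
      have hc3 : ((s ^ 4 * t * s ^ 5 * t) ^ 2).IsThreeCycle := by
        rw [← card_support_eq_three_iff]
        decide +kernel
      have horbit : ∀ x : Fin 22, x ≠ 2 → ∃ i : Fin 21,
          ((s * t * s ^ 2 * t * s ^ 2 * t) ^ (i : ℕ)) 1 = x := by decide +kernel
      refine Perm.alternatingGroup_le_of_isPreprimitive_of_isThreeCycle_mem ?_ hc3 hc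
      refine isPreprimitive_of_zpow_smul_eq (a := (2 : Fin 22)) (b := 1)
        (w := ⟨_, hw⟩) (h := ⟨s, hs⟩) ?_ ?_ fun x hx => ?_
      · show (s * t * s ^ 2 * t * s ^ 2 * t) 2 = 2
        decide +kernel
      · show s 1 = 2
        decide +kernel
      · obtain ⟨i, hi⟩ := horbit x hx
        refine ⟨(i : ℕ), ?_⟩
        rw [zpow_natCast]
        exact hi
end
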